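/- arXiv:2208.04550 — 5 statements merged into one kernel-verified Lean document; each statement's English description precedes it below -/
import Mathlib

section
/- Let G be a finite group with subgroups H₁ and H₂, and let A : G → ℂ be bi-invariant. For i = 1, 2, equip the space of right-H_i-invariant functions f : G → ℂ (i.e. f(x*h) = f(x) for all h ∈ H_i) with the inner product ⟨f,g⟩_i = (1/#H_i) ∑_{x ∈ G} conj(f(x)) * g(x), and define the intertwining operator 𝒜 by (𝒜 f)(x) = (1/#H₁) ∑_{y ∈ G} A(x⁻¹ * y) * f(y). Then 𝒜 maps right-H₁-invariant functions to right-H₂-invariant functions, and 𝒜 preserves inner products (⟨𝒜f, 𝒜g⟩₂ = ⟨f,g⟩₁ for all right-H₁-invariant f, g) if and only if A satisfies the convolution condition. -/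
open scoped BigOperators

/-- The intertwining operator `𝒜 f (x) = (1/#H₁) ∑_{y ∈ G} A(x⁻¹ y) f(y)`. -/
noncomputable def intertwineOp {G : Type*} [Group G] [Fintype G] (H₁ : Subgroup G)
    (A : G → ℂ) (f : G → ℂ) : G → ℂ :=
  fun x => ((Nat.card H₁ : ℂ))⁻¹ * ∑ y : G, A (x⁻¹ * y) * f y

/-- The autocorrelation `a ↦ ∑ b, conj (A b) * A (b * a)` of a function on a finite group. -/
noncomputable def autocorrelation {G : Type*} [Group G] [Fintype G] (A : G → ℂ) (a : G) : ℂ :=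
  ∑ b : G, (starRingEnd ℂ) (A b) * A (b * a)

theorem sum_conj_intertwineOp_mul {G : Type*} [Group G] [Fintype G] (H : Subgroup G)
    (A f g : G → ℂ) :
    ∑ x : G, (starRingEnd ℂ) (intertwineOp H A f x) * intertwineOp H A g x
      = ((Nat.card H : ℂ))⁻¹ * ((Nat.card H : ℂ))⁻¹ *
        ∑ y : G, ∑ z : G, (starRingEnd ℂ) (f y) * g z * autocorrelation A (y⁻¹ * z) := by
  have key (y z : G) : autocorrelation A (y⁻¹ * z)
      = ∑ x : G, (starRingEnd ℂ) (A (x⁻¹ * y)) * A (x⁻¹ * z) := by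
    refine (Fintype.sum_equiv ((Equiv.inv G).trans (Equiv.mulRight y)) _ _ fun x => ?_).symm
    simp [mul_assoc]
  simp only [intertwineOp, key, map_mul, map_sum, map_inv₀, Complex.conj_natCast]
  simp only [mul_mul_mul_comm _ (∑ _, _), Finset.sum_mul_sum, ← Finset.mul_sum]
  rw [Finset.sum_comm]
  congr 1
  refine Finset.sum_congr rfl fun y _ => ?_
  simp only [Finset.mul_sum]
  rw [Finset.sum_comm]
  refine Finset.sum_congr rfl fun z _ => ?_
  exact Finset.sum_congr rfl fun x _ => by ring

theorem sum_indicator_subgroup {G : Type*} [Group G] [Fintype G] (H : Subgroup G)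
    [DecidablePred (· ∈ H)] (a : G) :
    ∑ x : G, (if a⁻¹ * x ∈ H then (1 : ℂ) else 0) = Nat.card H := by
  refine (Equiv.sum_comp (Equiv.mulLeft a⁻¹) fun x => if x ∈ H then (1 : ℂ) else 0).trans ?_
  rw [Finset.sum_boole, Nat.card_eq_fintype_card, Fintype.card_subtype]

theorem autocorrelation_mul_mul {G : Type*} [Group G] [Fintype G] {H : Subgroup G} {A : G → ℂ}
    (hA : ∀ (a : G), ∀ h ∈ H, A (a * h) = A a) {h k : G} (hh : h ∈ H) (hk : k ∈ H) (a : G) :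
    autocorrelation A (h * a * k) = autocorrelation A a := by
  refine Fintype.sum_equiv (Equiv.mulRight h) _ _ fun b => ?_
  rw [Equiv.coe_mulRight, hA b h hh, ← mul_assoc, hA _ k hk, mul_assoc b h a]

theorem stmt0 {G : Type*} [Group G] [Fintype G] (H₁ H₂ : Subgroup G) (A : G → ℂ)
    (hbi : ∀ (a : G), ∀ h₁ ∈ H₁, ∀ h₂ ∈ H₂, A (h₂ * a * h₁) = A a) :
    (∀ f : G → ℂ, (∀ (x : G), ∀ h ∈ H₁, f (x * h) = f x) →
      ∀ (x : G), ∀ h ∈ H₂, intertwineOp H₁ A f (x * h) = intertwineOp H₁ A f x)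
    ∧
    ((∀ f g : G → ℂ, (∀ (x : G), ∀ h ∈ H₁, f (x * h) = f x) →
        (∀ (x : G), ∀ h ∈ H₁, g (x * h) = g x) →
        ((Nat.card H₂ : ℂ))⁻¹ *
            ∑ x : G, (starRingEnd ℂ) (intertwineOp H₁ A f x) * intertwineOp H₁ A g x
          = ((Nat.card H₁ : ℂ))⁻¹ * ∑ x : G, (starRingEnd ℂ) (f x) * g x)
      ↔ (∀ a : G,
          (a ∈ H₁ → ∑ b : G, (starRingEnd ℂ) (A b) * A (b * a) = (Nat.card H₂ : ℂ))
          ∧ (a ∉ H₁ → ∑ b : G, (starRingEnd ℂ) (A b) * A (b * a) = 0))) := by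
  classical
  have hcard (H : Subgroup G) : (Nat.card H : ℂ) ≠ 0 := Nat.cast_ne_zero.mpr Nat.card_pos.ne'
  have h1 := hcard H₁
  have h2 := hcard H₂
  have hR (a : G) (h : G) (hh : h ∈ H₁) : A (a * h) = A a := by
    simpa using hbi a h hh 1 H₂.one_mem
  refine ⟨fun f _ x h hh => ?_, fun hiso a => ?_, fun hconv f g _ hg => ?_⟩
  · have hL (a : G) : A (h⁻¹ * a) = A a := by
      simpa using hbi a 1 H₁.one_mem h⁻¹ (H₂.inv_mem hh)
    simp only [intertwineOp, mul_inv_rev, mul_assoc, hL]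
  · have hinv (c x h : G) (hh : h ∈ H₁) :
        (if c⁻¹ * (x * h) ∈ H₁ then (1 : ℂ) else 0) = if c⁻¹ * x ∈ H₁ then 1 else 0 := by
      rw [← mul_assoc, H₁.mul_mem_cancel_right hh]
    have hfg := hiso (fun x => if 1⁻¹ * x ∈ H₁ then 1 else 0)
      (fun x => if a⁻¹ * x ∈ H₁ then 1 else 0) (hinv 1) (hinv a)
    have hsum : ∑ y : G, ∑ z : G, (starRingEnd ℂ) (if 1⁻¹ * y ∈ H₁ then (1 : ℂ) else 0) *
        (if a⁻¹ * z ∈ H₁ then 1 else 0) * autocorrelation A (y⁻¹ * z)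
        = Nat.card H₁ * Nat.card H₁ * autocorrelation A a := by
      nth_rewrite 1 [← sum_indicator_subgroup H₁ 1]
      rw [← sum_indicator_subgroup H₁ a, Finset.sum_mul_sum]
      simp only [Finset.sum_mul]
      refine Finset.sum_congr rfl fun y _ => Finset.sum_congr rfl fun z _ => ?_
      rw [inv_one, one_mul]
      by_cases hy : y ∈ H₁
      · by_cases hz : a⁻¹ * z ∈ H₁
        · have := autocorrelation_mul_mul hR (H₁.inv_mem hy) hz a
          rw [mul_assoc, mul_inv_cancel_left] at this
          simp [hy, hz, this]
        · simp [hz]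
      · simp [hy]
    rw [sum_conj_intertwineOp_mul, hsum] at hfg
    have hC : autocorrelation A a = Nat.card H₂ * ((Nat.card H₁ : ℂ)⁻¹ *
        ∑ x : G, (starRingEnd ℂ) (if 1⁻¹ * x ∈ H₁ then (1 : ℂ) else 0) *
          (if a⁻¹ * x ∈ H₁ then 1 else 0)) := by
      rw [← hfg]
      field_simp
    change (_ → autocorrelation A a = _) ∧ (_ → autocorrelation A a = _)
    rw [hC]
    refine ⟨fun ha => ?_, fun ha => ?_⟩
    · have : ∀ x : G, (starRingEnd ℂ) (if 1⁻¹ * x ∈ H₁ then (1 : ℂ) else 0) *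
          (if a⁻¹ * x ∈ H₁ then 1 else 0) = if 1⁻¹ * x ∈ H₁ then 1 else 0 := fun x => by
        rw [H₁.mul_mem_cancel_left (H₁.inv_mem ha), inv_one, one_mul]
        split_ifs <;> simp
      rw [Finset.sum_congr rfl fun x _ => this x, sum_indicator_subgroup, inv_mul_cancel₀ h1,
        mul_one]
    · rw [Finset.sum_eq_zero, mul_zero, mul_zero]
      intro x _
      by_cases hx : x ∈ H₁
      · have : a⁻¹ * x ∉ H₁ := by rwa [H₁.mul_mem_cancel_right hx, H₁.inv_mem_iff]
        simp [this]
      · simp [hx]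
  · have hC (a : G) : autocorrelation A a = Nat.card H₂ * if a ∈ H₁ then 1 else 0 := by
      by_cases ha : a ∈ H₁
      · simpa [autocorrelation, ha] using (hconv a).1 ha
      · simpa [autocorrelation, ha] using (hconv a).2 ha
    have hy (y : G) : ∑ z : G, (starRingEnd ℂ) (f y) * g z * autocorrelation A (y⁻¹ * z)
        = Nat.card H₂ * Nat.card H₁ * ((starRingEnd ℂ) (f y) * g y) := by
      rw [← sum_indicator_subgroup H₁ y, Finset.mul_sum, Finset.sum_mul]
      refine Finset.sum_congr rfl fun z _ => ?_
      rw [hC]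
      by_cases hz : y⁻¹ * z ∈ H₁
      · have := hg y _ hz
        rw [mul_inv_cancel_left] at this
        rw [this]
        ring
      · simp [hz]
    rw [sum_conj_intertwineOp_mul, Finset.sum_congr rfl fun y _ => hy y, ← Finset.mul_sum]
    field_simp
end

section
/- Let G be a finite group with subgroups H₁ and H₂ of equal cardinality (#H₁ = #H₂), and let A : G → ℂ be bi-invariant and satisfy the convolution condition. Then the adjoint symbol A⋆ satisfies the dual convolution condition; explicitly, for every a ∈ G, ∑_{b ∈ G} A(a * b) * conj(A(b)) equals #H₁ when a ∈ H₂ and equals 0 when a ∉ H₂. -/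
open scoped BigOperators

section ConvolutionMatrix

open scoped Matrix

variable {G : Type*} [Group G]

/-- The matrix of the convolution operator with symbol `f`. -/
def convMatrix (f : G → ℂ) : Matrix G G ℂ := Matrix.of fun x y => f (x⁻¹ * y)

open Classical in
/-- The indicator function of a subgroup, with complex values. -/
noncomputable def subgroupIndicator (H : Subgroup G) (x : G) : ℂ := if x ∈ H then 1 else 0

lemma conjTranspose_convMatrix_subgroupIndicator (H : Subgroup G) :
    (convMatrix (subgroupIndicator H))ᴴ = convMatrix (subgroupIndicator H) := by
  ext x y
  have h : y⁻¹ * x ∈ H ↔ x⁻¹ * y ∈ H := by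
    rw [← H.inv_mem_iff, mul_inv_rev, inv_inv]
  by_cases hxy : x⁻¹ * y ∈ H
  · simp [convMatrix, subgroupIndicator, hxy, h.2 hxy]
  · simp [convMatrix, subgroupIndicator, hxy, mt h.1 hxy]

variable [Fintype G]

lemma sum_subgroupIndicator (H : Subgroup G) :
    ∑ x : G, subgroupIndicator H x = (Nat.card H : ℂ) := by
  classical
  simp [subgroupIndicator, Finset.sum_boole, Nat.card_eq_fintype_card, Fintype.card_subtype]

lemma convMatrix_subgroupIndicator_mul (H : Subgroup G) (f : G → ℂ)
    (hf : ∀ h ∈ H, ∀ a, f (h * a) = f a) :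
    convMatrix (subgroupIndicator H) * convMatrix f = (Nat.card H : ℂ) • convMatrix f := by
  ext x y
  simp only [Matrix.mul_apply, Matrix.smul_apply, smul_eq_mul, convMatrix, Matrix.of_apply]
  rw [← sum_subgroupIndicator, Finset.sum_mul, ← Equiv.sum_comp (Equiv.mulLeft x)]
  refine Finset.sum_congr rfl fun k _ => ?_
  by_cases hk : k ∈ H
  · simp [mul_assoc, hf _ (H.inv_mem hk)]
  · simp [subgroupIndicator, hk]

lemma convMatrix_mul_subgroupIndicator (H : Subgroup G) (f : G → ℂ)
    (hf : ∀ h ∈ H, ∀ a, f (a * h) = f a) :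
    convMatrix f * convMatrix (subgroupIndicator H) = (Nat.card H : ℂ) • convMatrix f := by
  ext x y
  simp only [Matrix.mul_apply, Matrix.smul_apply, smul_eq_mul, convMatrix, Matrix.of_apply]
  rw [← sum_subgroupIndicator, Finset.sum_mul,
    ← ((Equiv.inv G).trans (Equiv.mulLeft y)).sum_comp]
  refine Finset.sum_congr rfl fun k _ => ?_
  by_cases hk : k ∈ H
  · simp [← mul_assoc, hf _ (H.inv_mem hk), mul_comm]
  · simp [subgroupIndicator, hk]

lemma conjTranspose_mul_convMatrix (f : G → ℂ) :
    (convMatrix f)ᴴ * convMatrix f =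
      convMatrix fun a => ∑ b : G, (starRingEnd ℂ) (f b) * f (b * a) := by
  ext x y
  simp only [Matrix.mul_apply, convMatrix, Matrix.of_apply, Matrix.conjTranspose_apply]
  rw [← ((Equiv.inv G).trans (Equiv.mulLeft x)).sum_comp]
  simp [mul_assoc]

lemma convMatrix_mul_conjTranspose (f : G → ℂ) :
    convMatrix f * (convMatrix f)ᴴ =
      convMatrix fun a => ∑ b : G, f (a * b) * (starRingEnd ℂ) (f b) := by
  ext x y
  simp only [Matrix.mul_apply, convMatrix, Matrix.of_apply, Matrix.conjTranspose_apply]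
  rw [← Equiv.sum_comp (Equiv.mulLeft y) fun g => f (x⁻¹ * g) * star (f (y⁻¹ * g))]
  simp [mul_assoc]

lemma trace_convMatrix_subgroupIndicator (H : Subgroup G) :
    (convMatrix (subgroupIndicator H)).trace = (Fintype.card G : ℂ) := by
  simp [Matrix.trace, convMatrix, subgroupIndicator, H.one_mem]

open scoped ComplexOrder in
/-- Let `c` be real. If `Mᴴ * M = c • P` and `M * P = c • M`, where `Q` is Hermitian of the same trace as `P`,
`Q * Q = c • Q` and `Q * M = c • M`, then `M * Mᴴ = c • Q`. -/
lemma mul_conjTranspose_eq_smul_of_trace_eq {n : Type*} [Fintype n] {M P Q : Matrix n n ℂ} {c : ℂ}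
    (hc : star c = c) (hMM : Mᴴ * M = c • P) (hMP : M * P = c • M) (hQ : Qᴴ = Q)
    (hQQ : Q * Q = c • Q) (hQM : Q * M = c • M) (htr : P.trace = Q.trace) :
    M * Mᴴ = c • Q := by
  have hMQ : Mᴴ * Q = c • Mᴴ := by
    simpa [hQ, hc, Matrix.conjTranspose_smul] using congrArg Matrix.conjTranspose hQM
  set D := c • Q - M * Mᴴ with hD
  have hDH : Dᴴ = D := by
    rw [hD, Matrix.conjTranspose_sub, Matrix.conjTranspose_smul, hc, hQ,
      Matrix.conjTranspose_mul, Matrix.conjTranspose_conjTranspose]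
  have hQMM : Q * (M * Mᴴ) = c • (M * Mᴴ) := by rw [← mul_assoc, hQM, Matrix.smul_mul]
  have hMMQ : M * Mᴴ * Q = c • (M * Mᴴ) := by rw [mul_assoc, hMQ, Matrix.mul_smul]
  have hMMMM : M * Mᴴ * (M * Mᴴ) = (c * c) • (M * Mᴴ) := by
    rw [mul_assoc, ← mul_assoc Mᴴ, hMM, Matrix.smul_mul, Matrix.mul_smul, ← mul_assoc, hMP,
      Matrix.smul_mul, smul_smul]
  have hDD : D * D = (c * c) • D := by
    simp only [hD, sub_mul, mul_sub, Matrix.smul_mul, Matrix.mul_smul, hQQ, hQMM, hMMQ, hMMMM,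
      smul_sub, smul_smul, mul_assoc c]
    abel
  have hDtr : D.trace = 0 := by
    rw [hD, Matrix.trace_sub, Matrix.trace_mul_comm, hMM, Matrix.trace_smul,
      Matrix.trace_smul, htr, sub_self]
  have hD0 : D = 0 := by
    rw [← Matrix.trace_conjTranspose_mul_self_eq_zero_iff, hDH, hDD, Matrix.trace_smul,
      hDtr, smul_zero]
  exact (sub_eq_zero.mp hD0).symm

end ConvolutionMatrix

theorem stmt2 {G : Type*} [Group G] [Fintype G] (H₁ H₂ : Subgroup G) (A : G → ℂ)
    (hcard : Nat.card H₁ = Nat.card H₂)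
    (hbi : ∀ (a : G), ∀ h₁ ∈ H₁, ∀ h₂ ∈ H₂, A (h₂ * a * h₁) = A a)
    (hconv : ∀ a : G,
      (a ∈ H₁ → ∑ b : G, (starRingEnd ℂ) (A b) * A (b * a) = (Nat.card H₂ : ℂ))
      ∧ (a ∉ H₁ → ∑ b : G, (starRingEnd ℂ) (A b) * A (b * a) = 0)) :
    ∀ a : G,
      (a ∈ H₂ → ∑ b : G, A (a * b) * (starRingEnd ℂ) (A b) = (Nat.card H₁ : ℂ))
      ∧ (a ∉ H₂ → ∑ b : G, A (a * b) * (starRingEnd ℂ) (A b) = 0) := by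
  have hleft : ∀ h ∈ H₂, ∀ a, A (h * a) = A a := fun h hh a => by
    simpa using hbi a 1 H₁.one_mem h hh
  have hright : ∀ h ∈ H₁, ∀ a, A (a * h) = A a := fun h hh a => by
    simpa using hbi a h hh 1 H₂.one_mem
  have key := mul_conjTranspose_eq_smul_of_trace_eq (M := convMatrix A)
    (P := convMatrix (subgroupIndicator H₁)) (Q := convMatrix (subgroupIndicator H₂))
    (c := (Nat.card H₁ : ℂ)) (by simp)
    (by
      rw [conjTranspose_mul_convMatrix]
      ext x y
      by_cases h : x⁻¹ * y ∈ H₁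
      · simp [convMatrix, subgroupIndicator, h, (hconv _).1 h, hcard]
      · simp [convMatrix, subgroupIndicator, h, (hconv _).2 h])
    (by rw [convMatrix_mul_subgroupIndicator _ _ hright])
    (conjTranspose_convMatrix_subgroupIndicator H₂)
    (by
      rw [convMatrix_subgroupIndicator_mul, ← hcard]
      intro h hh a
      unfold subgroupIndicator
      congr 1
      exact propext (H₂.mul_mem_cancel_left hh))
    (by rw [convMatrix_subgroupIndicator_mul _ _ hleft, ← hcard])
    (by simp only [trace_convMatrix_subgroupIndicator])
  intro a
  rw [convMatrix_mul_conjTranspose] at key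
  have ha := congrFun (congrFun key 1) a
  simp only [convMatrix, Matrix.smul_apply, Matrix.of_apply,
    inv_one, one_mul, smul_eq_mul] at ha
  rw [ha]
  constructor <;> intro h <;> simp [subgroupIndicator, h]
end

section
/- Let G be a finite group with subgroups H₁ and H₂ acting on a set X, and let A : G → ℂ be bi-invariant and satisfy the convolution condition. Then for every H₁-invariant function f : X → ℂ, the pointwise identity Ũ_{A⋆}(Ũ_A f) = (#H₁ * #H₂) · f holds on all of X. -/
open scoped BigOperators

/-- The finite Radon transform
`(Ũ_A f)(x) = (1/#H₁) ∑_{a ∈ G} ∑_{h ∈ H₂} A(a) f(a⁻¹ • (h • x))`. -/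
noncomputable def URadon {G X : Type*} [Group G] [Fintype G] (H₁ H₂ : Subgroup G)
    [Fintype H₂] [MulAction G X] (A : G → ℂ) (f : X → ℂ) : X → ℂ :=
  fun x => ((Nat.card H₁ : ℂ))⁻¹ * ∑ a : G, ∑ h : H₂, A a * f (a⁻¹ • ((h : G) • x))

/-- The dual finite Radon transform, associated to `A⋆(a) = conj (A a⁻¹)`:
`(Ũ_{A⋆} g)(x) = (1/#H₂) ∑_{a ∈ G} ∑_{h ∈ H₁} A⋆(a) g(a⁻¹ • (h • x))`. -/
noncomputable def URadonDual {G X : Type*} [Group G] [Fintype G] (H₁ H₂ : Subgroup G)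
    [Fintype H₁] [MulAction G X] (A : G → ℂ) (g : X → ℂ) : X → ℂ :=
  fun x => ((Nat.card H₂ : ℂ))⁻¹ *
    ∑ a : G, ∑ h : H₁, (starRingEnd ℂ) (A a⁻¹) * g (a⁻¹ • ((h : G) • x))

/-- Averaging over a subgroup is redundant for a left-invariant symbol. -/
theorem sum_sum_mul_inv_smul_of_left_invariant {G X : Type*} [Group G] [Fintype G]
    (H : Subgroup G) [Fintype H] [MulAction G X] (B : G → ℂ)
    (hB : ∀ h ∈ H, ∀ a : G, B (h * a) = B a) (f : X → ℂ) (x : X) :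
    ∑ a : G, ∑ h : H, B a * f (a⁻¹ • ((h : G) • x))
      = (Nat.card H : ℂ) * ∑ a : G, B a * f (a⁻¹ • x) := by
  have translate (h : H) : ∑ a : G, B a * f (a⁻¹ • ((h : G) • x))
      = ∑ a : G, B a * f (a⁻¹ • x) := by
    rw [← Equiv.sum_comp (Equiv.mulLeft (h : G))]
    refine Finset.sum_congr rfl fun a _ => ?_
    simp [hB _ h.2, smul_smul, mul_assoc]
  rw [Finset.sum_comm]
  simp [translate, Nat.card_eq_fintype_card]

/-- The composition of the two unaveraged transforms is a convolution. -/
theorem sum_mul_sum_mul_inv_smul {G X : Type*} [Group G] [Fintype G] [MulAction G X]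
    (A : G → ℂ) (f : X → ℂ) (x : X) :
    ∑ b : G, (starRingEnd ℂ) (A b⁻¹) * ∑ a : G, A a * f (a⁻¹ • (b⁻¹ • x))
      = ∑ c : G, (∑ b : G, (starRingEnd ℂ) (A b) * A (b * c)) * f (c⁻¹ • x) := by
  simp_rw [Finset.sum_mul]
  rw [Finset.sum_comm, ← Equiv.sum_comp (Equiv.inv G)]
  refine Finset.sum_congr rfl fun b _ => ?_
  rw [← Equiv.sum_comp (Equiv.mulLeft b), Finset.mul_sum]
  refine Finset.sum_congr rfl fun c _ => ?_
  simp [smul_smul, mul_assoc]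

theorem stmt4 {G X : Type*} [Group G] [Fintype G] (H₁ H₂ : Subgroup G)
    [Fintype H₁] [Fintype H₂] [MulAction G X] (A : G → ℂ)
    (hbi : ∀ (a : G), ∀ h₁ ∈ H₁, ∀ h₂ ∈ H₂, A (h₂ * a * h₁) = A a)
    (hconv : ∀ a : G,
      (a ∈ H₁ → ∑ b : G, (starRingEnd ℂ) (A b) * A (b * a) = (Nat.card H₂ : ℂ))
      ∧ (a ∉ H₁ → ∑ b : G, (starRingEnd ℂ) (A b) * A (b * a) = 0))
    (f : X → ℂ) (hfinv : ∀ h ∈ H₁, ∀ x : X, f (h • x) = f x) :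
    ∀ x : X, URadonDual H₁ H₂ A (URadon H₁ H₂ A f) x
      = ((Nat.card H₁ : ℂ) * (Nat.card H₂ : ℂ)) * f x := by
  classical
  intro x
  have hA : ∀ h ∈ H₂, ∀ a : G, A (h * a) = A a := fun h hh a => by
    simpa using hbi a 1 H₁.one_mem h hh
  have hAdual : ∀ h ∈ H₁, ∀ a : G,
      (starRingEnd ℂ) (A (h * a)⁻¹) = (starRingEnd ℂ) (A a⁻¹) := fun h hh a => by
    simpa using congrArg (starRingEnd ℂ) (hbi a⁻¹ h⁻¹ (H₁.inv_mem hh) 1 H₂.one_mem)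
  have hterm (c : G) : (∑ b : G, (starRingEnd ℂ) (A b) * A (b * c)) * f (c⁻¹ • x)
      = if c ∈ H₁ then (Nat.card H₂ : ℂ) * f x else 0 := by
    split_ifs with hc
    · rw [(hconv c).1 hc, hfinv _ (H₁.inv_mem hc)]
    · rw [(hconv c).2 hc, zero_mul]
  have hsum : ∑ c : G, (if c ∈ H₁ then (Nat.card H₂ : ℂ) * f x else 0)
      = (Nat.card H₁ : ℂ) * ((Nat.card H₂ : ℂ) * f x) := by
    rw [← Finset.sum_filter, Finset.sum_const, nsmul_eq_mul, ← Fintype.card_subtype,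
      ← Nat.card_eq_fintype_card]
  have h₁ : (Nat.card H₁ : ℂ) ≠ 0 := Nat.cast_ne_zero.mpr Nat.card_pos.ne'
  have h₂ : (Nat.card H₂ : ℂ) ≠ 0 := Nat.cast_ne_zero.mpr Nat.card_pos.ne'
  have hU (y : X) : URadon H₁ H₂ A f y
      = (Nat.card H₁ : ℂ)⁻¹ * (Nat.card H₂ : ℂ) * ∑ a : G, A a * f (a⁻¹ • y) := by
    rw [URadon, sum_sum_mul_inv_smul_of_left_invariant H₂ A hA, mul_assoc]
  rw [URadonDual, sum_sum_mul_inv_smul_of_left_invariant H₁ _ hAdual]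
  simp_rw [hU, mul_left_comm _ ((Nat.card H₁ : ℂ)⁻¹ * (Nat.card H₂ : ℂ))]
  rw [← Finset.mul_sum, sum_mul_sum_mul_inv_smul, Finset.sum_congr rfl fun c _ => hterm c, hsum]
  field_simp
end

section
/- Let G be a finite group with subgroups H₁ and H₂ acting on a set X, and let A : G → ℂ be bi-invariant, satisfy the convolution condition, and be such that A⋆ satisfies the dual convolution condition. Then Ũ_{A⋆} ∘ Ũ_A = (#H₁ * #H₂) · Id on H₁-invariant functions and Ũ_A ∘ Ũ_{A⋆} = (#H₁ * #H₂) · Id on H₂-invariant functions; consequently (#H₁ * #H₂)^{-1/2} · Ũ_A is a bijection from the space of H₁-invariant functions X → ℂ onto the space of H₂-invariant functions X → ℂ, with inverse (#H₁ * #H₂)^{-1/2} · Ũ_{A⋆}. -/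
open scoped BigOperators

/-- The action of the group-algebra element with coefficients `A` on functions on `X`. -/
noncomputable def convAct {G X : Type*} [Group G] [Fintype G] [MulAction G X]
    (A : G → ℂ) (f : X → ℂ) : X → ℂ :=
  fun x => ∑ a : G, A a * f (a⁻¹ • x)

section ConvAct

variable {G X : Type*} [Group G] [Fintype G] [MulAction G X]

theorem convAct_const_mul (A : G → ℂ) (c : ℂ) (f : X → ℂ) (x : X) :
    convAct A (fun y => c * f y) x = c * convAct A f x := by
  simp only [convAct, Finset.mul_sum]
  exact Finset.sum_congr rfl fun a _ => by ring

theorem convAct_smul_of_left_invariant {A : G → ℂ} {h : G} (hA : ∀ a, A (h * a) = A a)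
    (f : X → ℂ) (x : X) : convAct A f (h • x) = convAct A f x := by
  unfold convAct
  rw [← Equiv.sum_comp (Equiv.mulLeft h)]
  refine Finset.sum_congr rfl fun a _ => ?_
  simp [hA, smul_smul, mul_assoc]

theorem sum_sum_subgroup_eq_card_mul_convAct (H : Subgroup G) [Fintype H] {A : G → ℂ}
    (hA : ∀ a, ∀ h ∈ H, A (h * a) = A a) (f : X → ℂ) (x : X) :
    ∑ a : G, ∑ h : H, A a * f (a⁻¹ • ((h : G) • x)) = (Nat.card H : ℂ) * convAct A f x := by
  rw [Finset.sum_comm]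
  calc ∑ h : H, ∑ a : G, A a * f (a⁻¹ • ((h : G) • x))
      = ∑ _h : H, convAct A f x := Finset.sum_congr rfl fun h _ =>
        convAct_smul_of_left_invariant (fun a => hA a h h.2) f x
    _ = (Nat.card H : ℂ) * convAct A f x := by simp [Nat.card_eq_fintype_card]

theorem convAct_convAct (B A : G → ℂ) (f : X → ℂ) (x : X) :
    convAct B (convAct A f) x = convAct (fun c => ∑ a : G, B a * A (a⁻¹ * c)) f x := by
  simp only [convAct, Finset.mul_sum, Finset.sum_mul]
  rw [Finset.sum_comm (s := Finset.univ) (t := Finset.univ)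
    (f := fun c a => B a * A (a⁻¹ * c) * f (c⁻¹ • x))]
  refine Finset.sum_congr rfl fun a _ => ?_
  rw [← Equiv.sum_comp (Equiv.mulLeft a) (fun c => B a * A (a⁻¹ * c) * f (c⁻¹ • x))]
  refine Finset.sum_congr rfl fun b _ => ?_
  simp [smul_smul, mul_assoc]

theorem convAct_eq_of_supported_on_subgroup (H : Subgroup G) {A : G → ℂ} {n : ℂ}
    (hA : ∀ a, (a ∈ H → A a = n) ∧ (a ∉ H → A a = 0)) {f : X → ℂ}
    (hf : ∀ h ∈ H, ∀ x : X, f (h • x) = f x) (x : X) :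
    convAct A f x = (Nat.card H : ℂ) * n * f x := by
  classical
  have key : ∀ a, A a * f (a⁻¹ • x) = if a ∈ H then n * f x else 0 := by
    intro a
    split_ifs with ha
    · rw [(hA a).1 ha, hf _ (H.inv_mem ha)]
    · rw [(hA a).2 ha, zero_mul]
  have hcard : (Finset.univ.filter (· ∈ H)).card = Nat.card H := by
    rw [Nat.card_eq_fintype_card, Fintype.card_subtype]
  simp only [convAct, key]
  rw [← Finset.sum_filter, Finset.sum_const, hcard, nsmul_eq_mul, mul_assoc]

end ConvAct

theorem stmt5 {G X : Type*} [Group G] [Fintype G] (H₁ H₂ : Subgroup G)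
    [Fintype H₁] [Fintype H₂] [MulAction G X] (A : G → ℂ)
    (hbi : ∀ (a : G), ∀ h₁ ∈ H₁, ∀ h₂ ∈ H₂, A (h₂ * a * h₁) = A a)
    (hconv : ∀ a : G,
      (a ∈ H₁ → ∑ b : G, (starRingEnd ℂ) (A b) * A (b * a) = (Nat.card H₂ : ℂ))
      ∧ (a ∉ H₁ → ∑ b : G, (starRingEnd ℂ) (A b) * A (b * a) = 0))
    (hdual : ∀ a : G,
      (a ∈ H₂ → ∑ b : G, A (a * b) * (starRingEnd ℂ) (A b) = (Nat.card H₁ : ℂ))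
      ∧ (a ∉ H₂ → ∑ b : G, A (a * b) * (starRingEnd ℂ) (A b) = 0)) :
    (∀ f : X → ℂ, (∀ h ∈ H₁, ∀ x : X, f (h • x) = f x) →
      ∀ x : X, URadonDual H₁ H₂ A (URadon H₁ H₂ A f) x
        = ((Nat.card H₁ : ℂ) * (Nat.card H₂ : ℂ)) * f x)
    ∧ (∀ g : X → ℂ, (∀ h ∈ H₂, ∀ x : X, g (h • x) = g x) →
      ∀ x : X, URadon H₁ H₂ A (URadonDual H₁ H₂ A g) x
        = ((Nat.card H₁ : ℂ) * (Nat.card H₂ : ℂ)) * g x)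
    ∧ Set.BijOn
        (fun f : X → ℂ => fun x =>
          (((Real.sqrt ((Nat.card H₁ : ℝ) * (Nat.card H₂ : ℝ)))⁻¹ : ℝ) : ℂ) *
            URadon H₁ H₂ A f x)
        {f : X → ℂ | ∀ h ∈ H₁, ∀ x : X, f (h • x) = f x}
        {g : X → ℂ | ∀ h ∈ H₂, ∀ x : X, g (h • x) = g x}
    ∧ Set.InvOn
        (fun g : X → ℂ => fun x =>
          (((Real.sqrt ((Nat.card H₁ : ℝ) * (Nat.card H₂ : ℝ)))⁻¹ : ℝ) : ℂ) *
            URadonDual H₁ H₂ A g x)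
        (fun f : X → ℂ => fun x =>
          (((Real.sqrt ((Nat.card H₁ : ℝ) * (Nat.card H₂ : ℝ)))⁻¹ : ℝ) : ℂ) *
            URadon H₁ H₂ A f x)
        {f : X → ℂ | ∀ h ∈ H₁, ∀ x : X, f (h • x) = f x}
        {g : X → ℂ | ∀ h ∈ H₂, ∀ x : X, g (h • x) = g x} := by
  have hcard₁ : (Nat.card H₁ : ℂ) ≠ 0 := Nat.cast_ne_zero.2 Nat.card_pos.ne'
  have hcard₂ : (Nat.card H₂ : ℂ) ≠ 0 := Nat.cast_ne_zero.2 Nat.card_pos.ne'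
  set B : G → ℂ := fun a => (starRingEnd ℂ) (A a⁻¹) with hB
  have hA_left : ∀ a, ∀ h ∈ H₂, A (h * a) = A a := fun a h hh => by
    simpa using hbi a 1 H₁.one_mem h hh
  have hB_left : ∀ a, ∀ h ∈ H₁, B (h * a) = B a := fun a h hh => by
    simpa [hB] using congrArg (starRingEnd ℂ) <| hbi a⁻¹ h⁻¹ (H₁.inv_mem hh) 1 H₂.one_mem
  have hU : ∀ f : X → ℂ, URadon H₁ H₂ A f =
      fun x => ((Nat.card H₁ : ℂ)⁻¹ * Nat.card H₂) * convAct A f x := fun f => by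
    funext x
    rw [URadon, sum_sum_subgroup_eq_card_mul_convAct H₂ hA_left, mul_assoc]
  have hV : ∀ g : X → ℂ, URadonDual H₁ H₂ A g =
      fun x => ((Nat.card H₂ : ℂ)⁻¹ * Nat.card H₁) * convAct B g x := fun g => by
    funext x
    rw [URadonDual, sum_sum_subgroup_eq_card_mul_convAct H₁ hB_left, mul_assoc]
  have hBA : ∀ c, ∑ a : G, B a * A (a⁻¹ * c) =
      ∑ b : G, (starRingEnd ℂ) (A b) * A (b * c) := fun c =>
    Equiv.sum_comp (Equiv.inv G) fun b => (starRingEnd ℂ) (A b) * A (b * c)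
  have hAB : ∀ c, ∑ a : G, A a * B (a⁻¹ * c) =
      ∑ b : G, A (c * b) * (starRingEnd ℂ) (A b) := fun c => by
    rw [← Equiv.sum_comp (Equiv.mulLeft c)]
    simp [hB]
  have hVU : ∀ f : X → ℂ, (∀ h ∈ H₁, ∀ x : X, f (h • x) = f x) →
      ∀ x : X, URadonDual H₁ H₂ A (URadon H₁ H₂ A f) x
        = ((Nat.card H₁ : ℂ) * (Nat.card H₂ : ℂ)) * f x := fun f hf x => by
    simp only [hU, hV]
    rw [convAct_const_mul, convAct_convAct,
      convAct_eq_of_supported_on_subgroup H₁ (by simpa only [hBA] using hconv) hf]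
    field_simp
  have hUV : ∀ g : X → ℂ, (∀ h ∈ H₂, ∀ x : X, g (h • x) = g x) →
      ∀ x : X, URadon H₁ H₂ A (URadonDual H₁ H₂ A g) x
        = ((Nat.card H₁ : ℂ) * (Nat.card H₂ : ℂ)) * g x := fun g hg x => by
    simp only [hU, hV]
    rw [convAct_const_mul, convAct_convAct,
      convAct_eq_of_supported_on_subgroup H₂ (by simpa only [hAB] using hdual) hg]
    field_simp
  have hU_mul : ∀ (c : ℂ) (f : X → ℂ) (x : X),
      URadon H₁ H₂ A (fun y => c * f y) x = c * URadon H₁ H₂ A f x := fun c f x => by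
    simp only [hU, convAct_const_mul]
    ring
  have hV_mul : ∀ (c : ℂ) (g : X → ℂ) (x : X),
      URadonDual H₁ H₂ A (fun y => c * g y) x = c * URadonDual H₁ H₂ A g x := fun c g x => by
    simp only [hV, convAct_const_mul]
    ring
  have hsqrt : ∀ z : ℂ,
      (((Real.sqrt ((Nat.card H₁ : ℝ) * (Nat.card H₂ : ℝ)))⁻¹ : ℝ) : ℂ) *
        ((((Real.sqrt ((Nat.card H₁ : ℝ) * (Nat.card H₂ : ℝ)))⁻¹ : ℝ) : ℂ) *
          (((Nat.card H₁ : ℂ) * (Nat.card H₂ : ℂ)) * z)) = z := fun z => by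
    rw [← mul_assoc, ← Complex.ofReal_mul, ← mul_inv, Real.mul_self_sqrt (by positivity)]
    push_cast
    field_simp
  refine ⟨hVU, hUV, ?_⟩
  rw [and_comm, and_iff_left_of_imp]
  · refine ⟨fun f hf => ?_, fun g hg => ?_⟩
    · funext x
      simp only [hV_mul, hVU f hf, hsqrt]
    · funext x
      simp only [hU_mul, hUV g hg, hsqrt]
  · refine fun hinv => hinv.bijOn (fun f _ h hh x => ?_) (fun g _ h hh x => ?_)
    · simp only [hU, convAct_smul_of_left_invariant fun a => hA_left a h hh]
    · simp only [hV, convAct_smul_of_left_invariant fun a => hB_left a h hh]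
end

section
/- Let G be a finite group with subgroups H₁ and H₂ acting on a set X, let A : G → ℂ be bi-invariant, satisfy the convolution condition, and be such that A⋆ satisfies the dual convolution condition, and let φ : X → X commute with the G-action (φ(a • x) = a • φ(x) for all a, x). Then the conjugated Koopman identity holds: for every H₂-invariant function g : X → ℂ, (1/(#H₁ * #H₂)) · Ũ_A((Ũ_{A⋆} g) ∘ φ) = g ∘ φ pointwise on X. -/
open scoped BigOperators

theorem URadon_eq_of_left_invariant {G X : Type*} [Group G] [Fintype G] (H₁ H₂ : Subgroup G)
    [Fintype H₂] [MulAction G X] (A : G → ℂ) (hA : ∀ h ∈ H₂, ∀ a : G, A (h * a) = A a)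
    (f : X → ℂ) (x : X) :
    URadon H₁ H₂ A f x =
      (Nat.card H₁ : ℂ)⁻¹ * ((Nat.card H₂ : ℂ) * ∑ a : G, A a * f (a⁻¹ • x)) := by
  have key (h : H₂) :
      ∑ a : G, A a * f (a⁻¹ • ((h : G) • x)) = ∑ a : G, A a * f (a⁻¹ • x) := by
    rw [← Equiv.sum_comp (Equiv.mulLeft (h : G))]
    refine Finset.sum_congr rfl fun a _ => ?_
    simp [hA h h.2, smul_smul]
  rw [URadon, Finset.sum_comm, Finset.sum_congr rfl fun h _ => key h]
  simp [Nat.card_eq_fintype_card]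

theorem URadonDual_eq_of_right_invariant {G X : Type*} [Group G] [Fintype G]
    (H₁ H₂ : Subgroup G) [Fintype H₁] [MulAction G X] (A : G → ℂ)
    (hA : ∀ h ∈ H₁, ∀ a : G, A (a * h) = A a) (g : X → ℂ) (x : X) :
    URadonDual H₁ H₂ A g x =
      (Nat.card H₂ : ℂ)⁻¹ *
        ((Nat.card H₁ : ℂ) * ∑ b : G, (starRingEnd ℂ) (A b) * g (b • x)) := by
  have h := URadon_eq_of_left_invariant H₂ H₁ (fun a => (starRingEnd ℂ) (A a⁻¹))
    (fun h hh a => by simp [hA h⁻¹ (H₁.inv_mem hh)]) g x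
  rw [← Equiv.sum_comp (Equiv.inv G)] at h
  change URadonDual H₁ H₂ A g x = _ at h
  simpa using h

theorem stmt8 {G X : Type*} [Group G] [Fintype G] (H₁ H₂ : Subgroup G)
    [Fintype H₁] [Fintype H₂] [MulAction G X] (A : G → ℂ)
    (hbi : ∀ (a : G), ∀ h₁ ∈ H₁, ∀ h₂ ∈ H₂, A (h₂ * a * h₁) = A a)
    (hconv : ∀ a : G,
      (a ∈ H₁ → ∑ b : G, (starRingEnd ℂ) (A b) * A (b * a) = (Nat.card H₂ : ℂ))
      ∧ (a ∉ H₁ → ∑ b : G, (starRingEnd ℂ) (A b) * A (b * a) = 0))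
    (hdual : ∀ a : G,
      (a ∈ H₂ → ∑ b : G, A (a * b) * (starRingEnd ℂ) (A b) = (Nat.card H₁ : ℂ))
      ∧ (a ∉ H₂ → ∑ b : G, A (a * b) * (starRingEnd ℂ) (A b) = 0))
    (φ : X → X) (hφ : ∀ (a : G) (x : X), φ (a • x) = a • φ x)
    (g : X → ℂ) (hginv : ∀ h ∈ H₂, ∀ x : X, g (h • x) = g x) :
    ∀ x : X,
      ((Nat.card H₁ : ℂ) * (Nat.card H₂ : ℂ))⁻¹ *
          URadon H₁ H₂ A ((URadonDual H₁ H₂ A g) ∘ φ) x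
        = g (φ x) := by
  intro x
  have hleft (h : G) (hh : h ∈ H₂) (a : G) : A (h * a) = A a := by
    simpa using hbi a 1 H₁.one_mem h hh
  have hright (h : G) (hh : h ∈ H₁) (a : G) : A (a * h) = A a := by
    simpa using hbi a h hh 1 H₂.one_mem
  classical
  have hsum : ∑ a : G, ∑ b : G, A a * ((starRingEnd ℂ) (A b) * g (b • a⁻¹ • φ x)) =
      (Nat.card H₁ : ℂ) * (Nat.card H₂ : ℂ) * g (φ x) := by
    calc
      _ = ∑ b : G, ∑ d : G, A (d * b) * (starRingEnd ℂ) (A b) * g (d⁻¹ • φ x) := by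
        rw [Finset.sum_comm]
        refine Finset.sum_congr rfl fun b _ => ?_
        rw [← Equiv.sum_comp (Equiv.mulRight b)]
        refine Finset.sum_congr rfl fun d _ => ?_
        simp [smul_smul, mul_assoc]
      _ = ∑ d : G, (∑ b : G, A (d * b) * (starRingEnd ℂ) (A b)) * g (d⁻¹ • φ x) := by
        rw [Finset.sum_comm]
        simp only [Finset.sum_mul]
      _ = ∑ d : G, if d ∈ H₂ then (Nat.card H₁ : ℂ) * g (φ x) else 0 := by
        refine Finset.sum_congr rfl fun d _ => ?_
        split_ifs with hd
        · rw [(hdual d).1 hd, hginv _ (H₂.inv_mem hd)]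
        · rw [(hdual d).2 hd, zero_mul]
      _ = _ := by
        rw [← Finset.sum_filter, Finset.sum_const, nsmul_eq_mul, Nat.card_eq_fintype_card (α := H₂),
          Fintype.card_subtype]
        ring
  have h₁ : (Nat.card H₁ : ℂ) ≠ 0 := Nat.cast_ne_zero.2 Nat.card_pos.ne'
  have h₂ : (Nat.card H₂ : ℂ) ≠ 0 := Nat.cast_ne_zero.2 Nat.card_pos.ne'
  have hcomp : ∑ a : G, A a * ((URadonDual H₁ H₂ A g) ∘ φ) (a⁻¹ • x) =
      (Nat.card H₂ : ℂ)⁻¹ * (Nat.card H₁ : ℂ) *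
        ((Nat.card H₁ : ℂ) * (Nat.card H₂ : ℂ) * g (φ x)) := by
    rw [← hsum, Finset.mul_sum]
    refine Finset.sum_congr rfl fun a _ => ?_
    rw [Function.comp_apply, hφ, URadonDual_eq_of_right_invariant H₁ H₂ A hright,
      ← Finset.mul_sum]
    ring
  rw [URadon_eq_of_left_invariant H₁ H₂ A hleft, hcomp]
  field_simp
end
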